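/- Fix σ ∈ ℝ, k ∈ ℤ and left U_q(g)-modules W_1, W_2. (i) If w_0 ∈ W_1 satisfies B_n^σ w_0 = ϑ_0(q^{σ+k}) w_0 and C_n w_0 = w_0, then B_n^σ (w_0 ⊗ w') = w_0 ⊗ (B_n^{σ+k} w') for all w' ∈ W_2. (ii) If w_+ ∈ W_1 satisfies B_n^σ w_+ = ϑ_k(q^σ) w_+ and C_n w_+ = q^k w_+, then B_n^σ (w_+ ⊗ w') = w_+ ⊗ (q^{−k} B_n^{σ−k} w') for all w' ∈ W_2; similarly, if w_− ∈ W_1 satisfies B_n^σ w_− = ϑ_k(−q^{−σ}) w_− and C_n w_− = q^k w_−, then B_n^σ (w_− ⊗ w') = w_− ⊗ (q^{−k} B_n^{σ+k} w') for all w' ∈ W_2. -/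

import Mathlib

namespace QG

/-- Generators of the quantized universal enveloping algebra `U_q(gl(m))`:
`K i`, its inverse `Ki i`, and the Chevalley generators `E j` (the `x_j`)
and `F j` (the `y_j`).  Indices are 1-based natural numbers; out-of-range
generators are forced to be `1` (resp. `0`) by the relations. -/
inductive Gen : Type where
  | K : ℕ → Gen
  | Ki : ℕ → Gen
  | E : ℕ → Gen
  | F : ℕ → Gen

abbrev FA := FreeAlgebra ℂ Gen

noncomputable def fK (i : ℕ) : FA := FreeAlgebra.ι ℂ (Gen.K i)
noncomputable def fKi (i : ℕ) : FA := FreeAlgebra.ι ℂ (Gen.Ki i)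
noncomputable def fE (i : ℕ) : FA := FreeAlgebra.ι ℂ (Gen.E i)
noncomputable def fF (i : ℕ) : FA := FreeAlgebra.ι ℂ (Gen.F i)

/-- Kronecker delta with values in `ℤ`. -/
def kd (i j : ℕ) : ℤ := if i = j then 1 else 0

/-- The defining relations of `U_q(gl(m))`. -/
inductive Rel (q : ℝ) (m : ℕ) : FA → FA → Prop
  | Kout : ∀ i, ¬(1 ≤ i ∧ i ≤ m) → Rel q m (fK i) 1
  | Kiout : ∀ i, ¬(1 ≤ i ∧ i ≤ m) → Rel q m (fKi i) 1
  | Eout : ∀ j, ¬(1 ≤ j ∧ j + 1 ≤ m) → Rel q m (fE j) 0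
  | Fout : ∀ j, ¬(1 ≤ j ∧ j + 1 ≤ m) → Rel q m (fF j) 0
  | KK : ∀ i j, Rel q m (fK i * fK j) (fK j * fK i)
  | KKi : ∀ i, Rel q m (fK i * fKi i) 1
  | KiK : ∀ i, Rel q m (fKi i * fK i) 1
  | KE : ∀ i j, 1 ≤ i → i ≤ m → 1 ≤ j → j + 1 ≤ m →
      Rel q m (fK i * fE j) (((q : ℂ) ^ (kd i j - kd i (j+1))) • (fE j * fK i))
  | KF : ∀ i j, 1 ≤ i → i ≤ m → 1 ≤ j → j + 1 ≤ m →
      Rel q m (fK i * fF j) (((q : ℂ) ^ (kd i (j+1) - kd i j)) • (fF j * fK i))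
  | EF : ∀ i j, 1 ≤ i → i + 1 ≤ m → 1 ≤ j → j + 1 ≤ m →
      Rel q m (fE i * fF j - fF j * fE i)
        (if i = j then ((q : ℂ) - (q : ℂ)⁻¹)⁻¹ • (fK i * fKi (i+1) - fKi i * fK (i+1)) else 0)
  | EE : ∀ i j, 1 ≤ i → i + 1 ≤ m → 1 ≤ j → j + 1 ≤ m → (i + 2 ≤ j ∨ j + 2 ≤ i) →
      Rel q m (fE i * fE j) (fE j * fE i)
  | FF : ∀ i j, 1 ≤ i → i + 1 ≤ m → 1 ≤ j → j + 1 ≤ m → (i + 2 ≤ j ∨ j + 2 ≤ i) →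
      Rel q m (fF i * fF j) (fF j * fF i)
  | Eserre : ∀ i j, 1 ≤ i → i + 1 ≤ m → 1 ≤ j → j + 1 ≤ m → (i + 1 = j ∨ j + 1 = i) →
      Rel q m (fE i ^ 2 * fE j - ((q : ℂ) + (q : ℂ)⁻¹) • (fE i * fE j * fE i) + fE j * fE i ^ 2) 0
  | Fserre : ∀ i j, 1 ≤ i → i + 1 ≤ m → 1 ≤ j → j + 1 ≤ m → (i + 1 = j ∨ j + 1 = i) →
      Rel q m (fF i ^ 2 * fF j - ((q : ℂ) + (q : ℂ)⁻¹) • (fF i * fF j * fF i) + fF j * fF i ^ 2) 0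

/-- The quantized universal enveloping algebra `U_q(gl(m))`. -/
abbrev Uq (q : ℝ) (m : ℕ) := RingQuot (Rel q m)

noncomputable def uK (q : ℝ) (m i : ℕ) : Uq q m := RingQuot.mkAlgHom ℂ (Rel q m) (fK i)
noncomputable def uKi (q : ℝ) (m i : ℕ) : Uq q m := RingQuot.mkAlgHom ℂ (Rel q m) (fKi i)
noncomputable def uE (q : ℝ) (m i : ℕ) : Uq q m := RingQuot.mkAlgHom ℂ (Rel q m) (fE i)
noncomputable def uF (q : ℝ) (m i : ℕ) : Uq q m := RingQuot.mkAlgHom ℂ (Rel q m) (fF i)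

/-- `C_i = K_i K_{2n+1-i}` in `U_q(gl(2n))`. -/
noncomputable def Cc (q : ℝ) (n i : ℕ) : Uq q (2*n) := uK q (2*n) i * uK q (2*n) (2*n+1-i)
/-- `C_i⁻¹ = K_i⁻¹ K_{2n+1-i}⁻¹` in `U_q(gl(2n))`. -/
noncomputable def Ccinv (q : ℝ) (n i : ℕ) : Uq q (2*n) := uKi q (2*n) i * uKi q (2*n) (2*n+1-i)
/-- `B_j = y_j K_{j+1}⁻¹ K_{2n-j}⁻¹ + K_j⁻¹ x_{2n-j} K_{2n-j}⁻¹` in `U_q(gl(2n))`. -/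
noncomputable def Bb (q : ℝ) (n j : ℕ) : Uq q (2*n) :=
  uF q (2*n) j * uKi q (2*n) (j+1) * uKi q (2*n) (2*n-j)
  + uKi q (2*n) j * uE q (2*n) (2*n-j) * uKi q (2*n) (2*n-j)
/-- `B_n^σ = y_n K_{n+1}⁻¹ K_n⁻¹ + K_n⁻¹ x_n K_n⁻¹ + ((q^{-σ}-q^{σ})/(q-q⁻¹)) K_n⁻²`. -/
noncomputable def Bs (q σ : ℝ) (n : ℕ) : Uq q (2*n) :=
  uF q (2*n) n * uKi q (2*n) (n+1) * uKi q (2*n) n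
  + uKi q (2*n) n * uE q (2*n) n * uKi q (2*n) n
  + (((q ^ (-σ) - q ^ σ) / (q - q⁻¹) : ℝ) : ℂ) • ((uKi q (2*n) n)^2)

/-- The generating set of the coideal subalgebra `𝒜_σ ⊆ U_q(gl(2n))`. -/
def ASet (q σ : ℝ) (n : ℕ) : Set (Uq q (2*n)) :=
  {z | (∃ i, 1 ≤ i ∧ i ≤ 2*n ∧ (z = Cc q n i ∨ z = Ccinv q n i)) ∨
       (∃ j, 1 ≤ j ∧ j + 1 ≤ 2*n ∧ j ≠ n ∧ z = Bb q n j) ∨ z = Bs q σ n}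

/-- Generators of the abstract algebra `𝒜`. -/
inductive AGen : Type where
  | g : ℕ → AGen
  | gi : ℕ → AGen
  | b : ℕ → AGen

abbrev AFA := FreeAlgebra ℂ AGen

noncomputable def fγ (i : ℕ) : AFA := FreeAlgebra.ι ℂ (AGen.g i)
noncomputable def fγi (i : ℕ) : AFA := FreeAlgebra.ι ℂ (AGen.gi i)
noncomputable def fβ (j : ℕ) : AFA := FreeAlgebra.ι ℂ (AGen.b j)

/-- `(ε_i + ε_{2n+1-i}, α_j)` where `α_j = ε_j - ε_{j+1}`. -/
def gex (n i j : ℕ) : ℤ := kd i j + kd (2*n+1-i) j - kd i (j+1) - kd (2*n+1-i) (j+1)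

/-- The defining relations of the algebra `𝒜`. -/
inductive ARel (q : ℝ) (n : ℕ) : AFA → AFA → Prop
  | gout : ∀ i, ¬(1 ≤ i ∧ i ≤ 2*n) → ARel q n (fγ i) 1
  | giout : ∀ i, ¬(1 ≤ i ∧ i ≤ 2*n) → ARel q n (fγi i) 1
  | bout : ∀ j, ¬(1 ≤ j ∧ j + 1 ≤ 2*n) → ARel q n (fβ j) 0
  | gg : ∀ i j, ARel q n (fγ i * fγ j) (fγ j * fγ i)
  | ggi : ∀ i, ARel q n (fγ i * fγi i) 1
  | gig : ∀ i, ARel q n (fγi i * fγ i) 1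
  | gsym : ∀ i, 1 ≤ i → i ≤ 2*n → ARel q n (fγ i) (fγ (2*n+1-i))
  | gb : ∀ i j, 1 ≤ i → i ≤ 2*n → 1 ≤ j → j + 1 ≤ 2*n →
      ARel q n (fγ i * fβ j) (((q : ℂ) ^ (-(gex n i j))) • (fβ j * fγ i))
  | bb : ∀ i j, 1 ≤ i → i + 1 ≤ 2*n → 1 ≤ j → j + 1 ≤ 2*n → (i + 2 ≤ j ∨ j + 2 ≤ i) →
      ARel q n (fβ i * fβ j - fβ j * fβ i)
        (if i + j = 2*n then ((q : ℂ) * ((q : ℂ) - (q : ℂ)⁻¹)⁻¹) • (fγi i ^ 2 - fγi (i+1) ^ 2)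
         else 0)
  | serre1 : ∀ i, 1 ≤ i → i + 2 ≤ 2*n →
      ARel q n
        ((q : ℂ)⁻¹ • (fβ i ^ 2 * fβ (i+1)) - ((q : ℂ) + (q : ℂ)⁻¹) • (fβ i * fβ (i+1) * fβ i)
          + (q : ℂ) • (fβ (i+1) * fβ i ^ 2))
        (if i = n then (q : ℂ) • (fβ (n+1) * fγi n ^ 2) else 0)
  | serre2 : ∀ i, 2 ≤ i → i + 1 ≤ 2*n →
      ARel q n
        ((q : ℂ) • (fβ i ^ 2 * fβ (i-1)) - ((q : ℂ) + (q : ℂ)⁻¹) • (fβ i * fβ (i-1) * fβ i)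
          + (q : ℂ)⁻¹ • (fβ (i-1) * fβ i ^ 2))
        (if i = n then (q : ℂ)⁻¹ • (fβ (n-1) * fγi n ^ 2) else 0)

/-- The abstract algebra `𝒜`. -/
abbrev Aalg (q : ℝ) (n : ℕ) := RingQuot (ARel q n)

noncomputable def aγ (q : ℝ) (n i : ℕ) : Aalg q n := RingQuot.mkAlgHom ℂ (ARel q n) (fγ i)
noncomputable def aγi (q : ℝ) (n i : ℕ) : Aalg q n := RingQuot.mkAlgHom ℂ (ARel q n) (fγi i)
noncomputable def aβ (q : ℝ) (n j : ℕ) : Aalg q n := RingQuot.mkAlgHom ℂ (ARel q n) (fβ j)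

end QG

namespace QG

/-- `ϑ_l(s) = (s⁻¹ − s q^{−2l})/(q − q⁻¹)`. -/
noncomputable def theta (q : ℝ) (l : ℤ) (s : ℝ) : ℝ := (s⁻¹ - s * q ^ ((-2) * l)) / (q - q⁻¹)

end QG

namespace QG

open scoped TensorProduct

theorem uK_mul_uKi (q : ℝ) (m i : ℕ) : uK q m i * uKi q m i = 1 := by
  rw [uK, uKi, ← map_mul, RingQuot.mkAlgHom_rel ℂ (Rel.KKi i), map_one]

theorem uKi_mul_uK (q : ℝ) (m i : ℕ) : uKi q m i * uK q m i = 1 := by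
  rw [uK, uKi, ← map_mul, RingQuot.mkAlgHom_rel ℂ (Rel.KiK i), map_one]

/-- The coefficient of `K_n⁻²` in `B_n^σ`. -/
noncomputable def cartanCoeff (q σ : ℝ) : ℝ := (q ^ (-σ) - q ^ σ) / (q - q⁻¹)

/-- The part `y_n K_{n+1}⁻¹ K_n⁻¹ + K_n⁻¹ x_n K_n⁻¹` of `B_n^σ` that does not depend on `σ`. -/
noncomputable def rootPart (q : ℝ) (n : ℕ) : Uq q (2*n) :=
  uF q (2*n) n * uKi q (2*n) (n+1) * uKi q (2*n) n
  + uKi q (2*n) n * uE q (2*n) n * uKi q (2*n) n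

theorem Bs_eq (q σ : ℝ) (n : ℕ) :
    Bs q σ n = rootPart q n + ((cartanCoeff q σ : ℝ) : ℂ) • (uKi q (2*n) n)^2 := rfl

/-- A left inverse of `C_n`. -/
theorem uKi_mul_uKi_mul_Cc (q : ℝ) (n : ℕ) :
    uKi q (2*n) (n+1) * uKi q (2*n) n * Cc q n n = 1 := by
  have h : 2 * n + 1 - n = n + 1 := by omega
  rw [Cc, h, mul_assoc, ← mul_assoc (uKi q (2*n) n), uKi_mul_uK, one_mul, uKi_mul_uK]

/-- The coproduct of `B_n^σ` is `B_n^σ ⊗ K_n⁻² + C_n⁻¹ ⊗ rootPart`. -/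
theorem coproduct_Bs (q σ : ℝ) (n : ℕ)
    (Δm : Uq q (2*n) →ₐ[ℂ] Uq q (2*n) ⊗[ℂ] Uq q (2*n))
    (hΔKi : ∀ i, Δm (uKi q (2*n) i) = uKi q (2*n) i ⊗ₜ[ℂ] uKi q (2*n) i)
    (hΔE : ∀ j, Δm (uE q (2*n) j) =
      uE q (2*n) j ⊗ₜ[ℂ] 1 + (uK q (2*n) j * uKi q (2*n) (j+1)) ⊗ₜ[ℂ] uE q (2*n) j)
    (hΔF : ∀ j, Δm (uF q (2*n) j) =
      uF q (2*n) j ⊗ₜ[ℂ] (uKi q (2*n) j * uK q (2*n) (j+1)) + 1 ⊗ₜ[ℂ] uF q (2*n) j) :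
    Δm (Bs q σ n) = Bs q σ n ⊗ₜ[ℂ] ((uKi q (2*n) n)^2)
      + (uKi q (2*n) (n+1) * uKi q (2*n) n) ⊗ₜ[ℂ] rootPart q n := by
  have h1 : uKi q (2*n) n * uK q (2*n) (n+1) * uKi q (2*n) (n+1) * uKi q (2*n) n
      = (uKi q (2*n) n)^2 := by
    rw [mul_assoc (uKi q (2*n) n), uK_mul_uKi, mul_one, sq]
  have h2 : uKi q (2*n) n * (uK q (2*n) n * uKi q (2*n) (n+1)) * uKi q (2*n) n
      = uKi q (2*n) (n+1) * uKi q (2*n) n := by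
    rw [← mul_assoc (uKi q (2*n) n), uKi_mul_uK, one_mul]
  rw [Bs_eq, rootPart]
  simp only [map_add, map_mul, map_smul, map_pow, hΔKi, hΔE, hΔF, add_mul, mul_add,
    Algebra.TensorProduct.tmul_mul_tmul, Algebra.TensorProduct.tmul_pow, one_mul, mul_one,
    TensorProduct.add_tmul, TensorProduct.tmul_add, TensorProduct.smul_tmul', h1, h2, ← sq]
  abel

/-- If `w` is a joint eigenvector of `B_n^σ` and `C_n`, with eigenvalues `c⁻¹ • cartanCoeff q τ`
and `c`, then `B_n^σ` acts on `w ⊗ w'` through `c⁻¹ • B_n^τ` on the second factor. -/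
theorem Bs_tmul_of_eigenvector {q σ τ : ℝ} {n : ℕ} {W1 W2 : Type*}
    [AddCommGroup W1] [Module ℂ W1] [AddCommGroup W2] [Module ℂ W2]
    (ρ1 : Uq q (2*n) →ₐ[ℂ] Module.End ℂ W1) (ρ2 : Uq q (2*n) →ₐ[ℂ] Module.End ℂ W2)
    (Δm : Uq q (2*n) →ₐ[ℂ] Uq q (2*n) ⊗[ℂ] Uq q (2*n))
    (hΔKi : ∀ i, Δm (uKi q (2*n) i) = uKi q (2*n) i ⊗ₜ[ℂ] uKi q (2*n) i)
    (hΔE : ∀ j, Δm (uE q (2*n) j) =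
      uE q (2*n) j ⊗ₜ[ℂ] 1 + (uK q (2*n) j * uKi q (2*n) (j+1)) ⊗ₜ[ℂ] uE q (2*n) j)
    (hΔF : ∀ j, Δm (uF q (2*n) j) =
      uF q (2*n) j ⊗ₜ[ℂ] (uKi q (2*n) j * uK q (2*n) (j+1)) + 1 ⊗ₜ[ℂ] uF q (2*n) j)
    {w : W1} {c : ℂ} (hc : c ≠ 0)
    (hB : ρ1 (Bs q σ n) w = (c⁻¹ * ((cartanCoeff q τ : ℝ) : ℂ)) • w)
    (hC : ρ1 (Cc q n n) w = c • w) (w' : W2) :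
    (Module.endTensorEndAlgHom (R := ℂ) (S := ℂ) (A := ℂ) (M := W1) (N := W2)).comp
        ((Algebra.TensorProduct.map ρ1 ρ2).comp Δm) (Bs q σ n) (w ⊗ₜ[ℂ] w')
      = w ⊗ₜ[ℂ] (c⁻¹ • ρ2 (Bs q τ n) w') := by
  have hCinv : ρ1 (uKi q (2*n) (n+1) * uKi q (2*n) n) w = c⁻¹ • w := by
    have h := congrArg (fun f => ρ1 f w) (uKi_mul_uKi_mul_Cc q n)
    simp only [map_mul ρ1 _ (Cc q n n), Module.End.mul_apply, hC, map_smul, map_one,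
      Module.End.one_apply] at h
    rw [eq_inv_smul_iff₀ hc, h]
  rw [AlgHom.comp_apply, AlgHom.comp_apply, coproduct_Bs q σ n Δm hΔKi hΔE hΔF, map_add, map_add,
    Algebra.TensorProduct.map_tmul, Algebra.TensorProduct.map_tmul,
    Module.endTensorEndAlgHom_apply, Module.endTensorEndAlgHom_apply, LinearMap.add_apply,
    TensorProduct.AlgebraTensorModule.map_tmul, TensorProduct.AlgebraTensorModule.map_tmul,
    hB, hCinv, Bs_eq q τ, map_add, map_smul, LinearMap.add_apply, LinearMap.smul_apply,
    TensorProduct.smul_tmul, TensorProduct.smul_tmul, ← TensorProduct.tmul_add, smul_add,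
    smul_smul, add_comm]

theorem theta_zero_rpow {q : ℝ} (hq : 0 < q) (τ : ℝ) :
    theta q 0 (q ^ τ) = cartanCoeff q τ := by
  simp [theta, cartanCoeff, Real.rpow_neg hq.le]

theorem theta_rpow {q : ℝ} (hq : 0 < q) (σ : ℝ) (k : ℤ) :
    theta q k (q ^ σ) = (q ^ k)⁻¹ * cartanCoeff q (σ - k) := by
  rw [theta, cartanCoeff, mul_div_assoc', ← Real.rpow_intCast, ← Real.rpow_intCast,
    ← Real.rpow_neg hq.le, ← Real.rpow_neg hq.le, mul_sub, ← Real.rpow_add hq,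
    ← Real.rpow_add hq, ← Real.rpow_add hq]
  push_cast
  ring_nf

theorem theta_neg_rpow_neg {q : ℝ} (hq : 0 < q) (σ : ℝ) (k : ℤ) :
    theta q k (-(q ^ (-σ))) = (q ^ k)⁻¹ * cartanCoeff q (σ + k) := by
  rw [theta, cartanCoeff, mul_div_assoc', ← Real.rpow_intCast, ← Real.rpow_intCast, inv_neg,
    ← Real.rpow_neg hq.le, ← Real.rpow_neg hq.le, mul_sub, neg_mul, ← Real.rpow_add hq,
    ← Real.rpow_add hq, ← Real.rpow_add hq]
  push_cast
  ring_nf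

end QG

open QG TensorProduct in
open scoped TensorProduct in
/-- Lemma on tensor products: (i) if `B_n^σ w₀ = ϑ_0(q^{σ+k}) w₀` and `C_n w₀ = w₀`, then
`B_n^σ (w₀ ⊗ w') = w₀ ⊗ (B_n^{σ+k} w')`; (ii) if `B_n^σ w₊ = ϑ_k(q^σ) w₊` and
`C_n w₊ = q^k w₊` then `B_n^σ (w₊ ⊗ w') = w₊ ⊗ (q^{−k} B_n^{σ−k} w')`, and if
`B_n^σ w₋ = ϑ_k(−q^{−σ}) w₋` and `C_n w₋ = q^k w₋` then
`B_n^σ (w₋ ⊗ w') = w₋ ⊗ (q^{−k} B_n^{σ+k} w')`. -/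
theorem statement_17 (q : ℝ) (hq0 : 0 < q) (hq1 : q < 1) (n : ℕ) (hn : 1 ≤ n)
    (σ : ℝ) (k : ℤ)
    (W1 W2 : Type) [AddCommGroup W1] [Module ℂ W1] [AddCommGroup W2] [Module ℂ W2]
    (ρ1 : Uq q (2*n) →ₐ[ℂ] Module.End ℂ W1) (ρ2 : Uq q (2*n) →ₐ[ℂ] Module.End ℂ W2)
    (Δm : Uq q (2*n) →ₐ[ℂ] Uq q (2*n) ⊗[ℂ] Uq q (2*n))
    (hΔK : ∀ i, Δm (uK q (2*n) i) = uK q (2*n) i ⊗ₜ[ℂ] uK q (2*n) i)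
    (hΔKi : ∀ i, Δm (uKi q (2*n) i) = uKi q (2*n) i ⊗ₜ[ℂ] uKi q (2*n) i)
    (hΔE : ∀ j, Δm (uE q (2*n) j) =
      uE q (2*n) j ⊗ₜ[ℂ] 1 + (uK q (2*n) j * uKi q (2*n) (j+1)) ⊗ₜ[ℂ] uE q (2*n) j)
    (hΔF : ∀ j, Δm (uF q (2*n) j) =
      uF q (2*n) j ⊗ₜ[ℂ] (uKi q (2*n) j * uK q (2*n) (j+1)) + 1 ⊗ₜ[ℂ] uF q (2*n) j) :
    ∀ ρT : Uq q (2*n) →ₐ[ℂ] Module.End ℂ (W1 ⊗[ℂ] W2),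
      ρT = (Module.endTensorEndAlgHom (R := ℂ) (S := ℂ) (A := ℂ)
              (M := W1) (N := W2)).comp ((Algebra.TensorProduct.map ρ1 ρ2).comp Δm) →
      ((∀ w0 : W1,
          ρ1 (Bs q σ n) w0 = ((theta q 0 (q ^ (σ + (k:ℝ))) : ℝ) : ℂ) • w0 →
          ρ1 (Cc q n n) w0 = w0 →
          ∀ w' : W2,
            ρT (Bs q σ n) (w0 ⊗ₜ[ℂ] w') = w0 ⊗ₜ[ℂ] (ρ2 (Bs q (σ + (k:ℝ)) n) w')) ∧
       (∀ wp : W1,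
          ρ1 (Bs q σ n) wp = ((theta q k (q ^ σ) : ℝ) : ℂ) • wp →
          ρ1 (Cc q n n) wp = ((q : ℂ) ^ k) • wp →
          ∀ w' : W2,
            ρT (Bs q σ n) (wp ⊗ₜ[ℂ] w')
              = wp ⊗ₜ[ℂ] (((q : ℂ) ^ (-k)) • (ρ2 (Bs q (σ - (k:ℝ)) n) w'))) ∧
       (∀ wm : W1,
          ρ1 (Bs q σ n) wm = ((theta q k (-(q ^ (-σ))) : ℝ) : ℂ) • wm →
          ρ1 (Cc q n n) wm = ((q : ℂ) ^ k) • wm →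
          ∀ w' : W2,
            ρT (Bs q σ n) (wm ⊗ₜ[ℂ] w')
              = wm ⊗ₜ[ℂ] (((q : ℂ) ^ (-k)) • (ρ2 (Bs q (σ + (k:ℝ)) n) w')))) := by
  rintro ρT rfl
  have hqk : (q : ℂ) ^ k ≠ 0 := zpow_ne_zero _ (by exact_mod_cast hq0.ne')
  refine ⟨fun w hB hC w' => ?_, fun w hB hC w' => ?_, fun w hB hC w' => ?_⟩
  · have h := Bs_tmul_of_eigenvector (τ := σ + k) (c := 1) ρ1 ρ2 Δm hΔKi hΔE hΔF one_ne_zero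
      (by rw [hB, theta_zero_rpow hq0, inv_one, one_mul]) (by rw [hC, one_smul]) w'
    rwa [inv_one, one_smul] at h
  · rw [zpow_neg]
    exact Bs_tmul_of_eigenvector ρ1 ρ2 Δm hΔKi hΔE hΔF hqk
      (by rw [hB, theta_rpow hq0]; push_cast; rfl) hC w'
  · rw [zpow_neg]
    exact Bs_tmul_of_eigenvector ρ1 ρ2 Δm hΔKi hΔE hΔF hqk
      (by rw [hB, theta_neg_rpow_neg hq0]; push_cast; rfl) hC w'
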